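/- arXiv:1603.05451 — 5 statements merged into one kernel-verified Lean document; each statement's English description precedes it below -/
import Mathlib

section
/- Let R be an associative unital ring which is an algebra over ℚ, let I be a two-sided ideal of R, and let n be a positive integer such that x^n = 0 for every x ∈ I. Then I is nilpotent: there exists a positive integer m such that every product of m elements of I is equal to 0. -/
open Finset in
/-- A polynomial function with values in a subspace has its coefficients in that subspace. -/
theorem Submodule.mem_of_forall_sum_pow_smul_mem {K M : Type*} [Field K] [CharZero K]
    [AddCommGroup M] [Module K M] (S : Submodule K M) (n : ℕ) (v : ℕ → M)
    (h : ∀ t : K, ∑ k ∈ range n, t ^ k • v k ∈ S) {k : ℕ} (hk : k < n) : v k ∈ S := by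
  let V : Matrix (Fin n) (Fin n) K := Matrix.vandermonde fun i => (i : K)
  have hV : V⁻¹ * V = 1 := by
    refine Matrix.nonsing_inv_mul _ (isUnit_iff_ne_zero.2 (Matrix.det_vandermonde_ne_zero_iff.2 ?_))
    intro i j hij
    exact Fin.ext (Nat.cast_injective hij)
  have key : v k = ∑ i : Fin n, V⁻¹ ⟨k, hk⟩ i • ∑ j ∈ range n, ((i : ℕ) : K) ^ j • v j := by
    calc v k = ∑ j : Fin n, (V⁻¹ * V) ⟨k, hk⟩ j • v j := by
          simp [hV, Matrix.one_apply, ite_smul]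
      _ = _ := by
          simp_rw [Matrix.mul_apply, sum_smul, ← Fin.sum_univ_eq_sum_range
            (fun j => (_ : K) ^ j • v j), smul_sum, smul_smul]
          exact sum_comm
  rw [key]
  exact S.sum_mem fun i _ => S.smul_mem _ (h _)

namespace Polynomial

open Finset

theorem coeff_one_C_add_C_mul_X_pow {R : Type*} [Semiring R] (x y : R) (n : ℕ) :
    ((C x + C y * X) ^ (n + 1)).coeff 1 = ∑ i ∈ range (n + 1), x ^ i * y * x ^ (n - i) := by
  have h0 (m : ℕ) : ((C x + C y * X) ^ m).coeff 0 = x ^ m := by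
    induction m with
    | zero => simp
    | succ m ih => simp [pow_succ, mul_coeff_zero, ih]
  induction n with
  | zero => simp [coeff_C]
  | succ n ih =>
    rw [pow_succ, mul_coeff_one, ih, h0, sum_range_succ _ (n + 1), sum_mul, add_comm]
    congr 1
    · refine sum_congr rfl fun i hi => ?_
      have hi' : n + 1 - i = n - i + 1 := by have := mem_range.1 hi; omega
      simp [hi', pow_succ, mul_assoc]
    · simp [coeff_C]

end Polynomial

namespace TwoSidedIdeal

open Finset

variable {R : Type*} [Ring R]

section Transporter

variable (I J : TwoSidedIdeal R) (T : Set R)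

/-- The elements `a` with `a * I * T ⊆ J`. -/
def leftTransporter : TwoSidedIdeal R :=
  .mk' {a | ∀ z ∈ I, ∀ t ∈ T, a * z * t ∈ J}
    (fun z _ t _ => by simp)
    (fun ha hb z hz t ht => by
      simpa only [add_mul] using J.add_mem (ha z hz t ht) (hb z hz t ht))
    (fun ha z hz t ht => by simpa only [neg_mul] using J.neg_mem (ha z hz t ht))
    (fun {r a} ha z hz t ht => by
      simpa only [mul_assoc] using J.mul_mem_left r _ (ha z hz t ht))
    (fun {a r} ha z hz t ht => by
      simpa only [mul_assoc] using ha (r * z) (I.mul_mem_left r z hz) t ht)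

/-- The elements `b` with `T * I * b ⊆ J`. -/
def rightTransporter : TwoSidedIdeal R :=
  .mk' {b | ∀ t ∈ T, ∀ z ∈ I, t * z * b ∈ J}
    (fun t _ z _ => by simp)
    (fun ha hb t ht z hz => by
      simpa only [mul_add] using J.add_mem (ha t ht z hz) (hb t ht z hz))
    (fun ha t ht z hz => by simpa only [mul_neg] using J.neg_mem (ha t ht z hz))
    (fun {r b} hb t ht z hz => by
      simpa only [mul_assoc] using hb t ht (z * r) (I.mul_mem_right z r hz))
    (fun {b r} hb t ht z hz => by
      simpa only [mul_assoc] using J.mul_mem_right _ r (hb t ht z hz))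

variable {I J T}

theorem mem_leftTransporter {a : R} :
    a ∈ leftTransporter I J T ↔ ∀ z ∈ I, ∀ t ∈ T, a * z * t ∈ J :=
  mem_mk' ..

theorem mem_rightTransporter {b : R} :
    b ∈ rightTransporter I J T ↔ ∀ t ∈ T, ∀ z ∈ I, t * z * b ∈ J :=
  mem_mk' ..

end Transporter

theorem smul_mem_of_algebra {K : Type*} [CommSemiring K] [Algebra K R] (J : TwoSidedIdeal R)
    (c : K) {a : R} (ha : a ∈ J) : c • a ∈ J := by
  rw [Algebra.smul_def]
  exact J.mul_mem_left _ _ ha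

variable [Algebra ℚ R] {I J : TwoSidedIdeal R} {n : ℕ}

open Polynomial in
/-- Linearization of the identity `x ^ (n + 1) = 0`. -/
theorem sum_pow_mul_mul_pow_mem (h : ∀ x ∈ I, x ^ (n + 1) ∈ J) {x y : R} (hx : x ∈ I)
    (hy : y ∈ I) : ∑ i ∈ range (n + 1), x ^ i * y * x ^ (n - i) ∈ J := by
  let S : Submodule ℚ R :=
    { carrier := {a | a ∈ J}
      add_mem' := J.add_mem
      zero_mem' := J.zero_mem
      smul_mem' := fun c _ ha => J.smul_mem_of_algebra c ha }
  let p : R[X] := (C x + C y * X) ^ (n + 1)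
  have hp : p.natDegree < n + 2 := by
    have h1 : (C x + C y * X).natDegree ≤ 1 := by compute_degree
    have := natDegree_pow_le_of_le (n + 1) h1
    simp only [p]
    omega
  rw [← coeff_one_C_add_C_mul_X_pow]
  refine S.mem_of_forall_sum_pow_smul_mem (n + 2) p.coeff (fun t => ?_) (by omega)
  have hev : ∑ k ∈ range (n + 2), t ^ k • p.coeff k = (x + t • y) ^ (n + 1) := by
    let φ : R[X] →+* R := eval₂RingHom' (RingHom.id R) (algebraMap ℚ R t)
      fun a => (Algebra.commutes t a).symm
    have hC (a : R) : φ (C a) = a := eval₂_C _ _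
    have hX : φ X = algebraMap ℚ R t := eval₂_X _ _
    have hφ : φ p = (x + t • y) ^ (n + 1) := by
      simp only [p, map_pow, map_add, map_mul, hC, hX, Algebra.smul_def, Algebra.commutes]
    rw [← hφ]
    change _ = p.eval _
    rw [eval_eq_sum_range' hp]
    exact sum_congr rfl fun k _ => by rw [Algebra.smul_def, Algebra.commutes, map_pow]
  rw [hev]
  exact h _ (I.add_mem hx (I.smul_mem_of_algebra t hy))

theorem pow_mul_mul_pow_mem (h : ∀ x ∈ I, x ^ (n + 1) ∈ J) {x y z : R} (hx : x ∈ I)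
    (hy : y ∈ I) (hz : z ∈ I) : x ^ n * z * y ^ n ∈ J := by
  let s (i j : ℕ) : R := x ^ i * (z * y ^ j) * x ^ (n - i) * y ^ (n - j)
  have hs : ∑ i ∈ range (n + 1), ∑ j ∈ range (n + 1), s i j ∈ J := by
    rw [sum_comm]
    refine sum_mem fun j _ => ?_
    rw [← sum_mul]
    exact J.mul_mem_right _ _ (sum_pow_mul_mul_pow_mem h hx (I.mul_mem_right z _ hz))
  have hlow : ∑ i ∈ range n, ∑ j ∈ range (n + 1), s i j ∈ J := by
    refine sum_mem fun i hi => ?_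
    obtain ⟨k, hk⟩ : ∃ k, n - i = k + 1 :=
      ⟨n - i - 1, by have := mem_range.1 hi; omega⟩
    have hxk : x ^ (n - i) ∈ I := by
      rw [hk, pow_succ]
      exact I.mul_mem_left _ _ hx
    convert J.mul_mem_left (x ^ i * z) _ (sum_pow_mul_mul_pow_mem h hy hxk) using 1
    simp only [s, mul_sum, mul_assoc]
  have htop : ∑ j ∈ range (n + 1), s n j = ((n + 1 : ℕ) : ℚ) • (x ^ n * z * y ^ n) := by
    rw [Nat.cast_smul_eq_nsmul, ← card_range (n + 1), ← sum_const, card_range]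
    refine sum_congr rfl fun j hj => ?_
    have hj' : j + (n - j) = n := by have := mem_range.1 hj; omega
    simp only [s, Nat.sub_self, pow_zero, one_mul, mul_assoc, ← pow_add, hj']
  rw [sum_range_succ, htop] at hs
  have hmul := J.sub_mem hs hlow
  rw [add_sub_cancel_left] at hmul
  have hdiv := J.smul_mem_of_algebra ((n + 1 : ℕ) : ℚ)⁻¹ hmul
  rwa [inv_smul_smul₀ (by positivity)] at hdiv

/-- The Nagata–Higman theorem relative to an ideal `J`. -/
theorem exists_prod_mem_of_pow_mem (n : ℕ) :
    ∀ J : TwoSidedIdeal R, (∀ x ∈ I, x ^ n ∈ J) →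
      ∃ m : ℕ, 0 < m ∧ ∀ l : List R, l.length = m → (∀ x ∈ l, x ∈ I) → l.prod ∈ J := by
  induction n with
  | zero =>
    intro J h
    refine ⟨1, one_pos, fun l _ _ => ?_⟩
    have h1 : (1 : R) ∈ J := by simpa using h 0 I.zero_mem
    simpa using J.mul_mem_left l.prod 1 h1
  | succ n ih =>
    intro J h
    let A := leftTransporter I J ((· ^ n) '' {x | x ∈ I})
    obtain ⟨p, -, hA⟩ := ih A fun x hx => mem_leftTransporter.2 <| by
      rintro z hz _ ⟨y, hy, rfl⟩
      exact pow_mul_mul_pow_mem h hx hy hz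
    obtain ⟨q, -, hB⟩ := ih (rightTransporter I J {a | a ∈ A}) fun x hx =>
      mem_rightTransporter.2 fun a ha z hz => mem_leftTransporter.1 ha z hz _ ⟨x, hx, rfl⟩
    refine ⟨p + (q + 1), by omega, fun l hl hlI => ?_⟩
    obtain ⟨z, r, hr⟩ : ∃ z r, l.drop p = z :: r :=
      List.exists_cons_of_length_pos (by simp; omega)
    have hrl : r.length = q := by
      have := congrArg List.length hr
      simp at this
      omega
    have hmem (x : R) (hx : x ∈ z :: r) : x ∈ I := hlI x (List.mem_of_mem_drop (hr ▸ hx))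
    rw [← List.take_append_drop p l, hr, List.prod_append, List.prod_cons, ← mul_assoc]
    exact mem_rightTransporter.1 (hB r hrl fun x hx => hmem x (List.mem_cons_of_mem _ hx)) _
      (hA (l.take p) (by simp; omega) fun x hx => hlI x (List.mem_of_mem_take hx))
      z (hmem z List.mem_cons_self)

end TwoSidedIdeal

/-- Nagata–Higman: a two-sided ideal of bounded nil exponent in a `ℚ`-algebra is
nilpotent. -/
theorem nagata_higman {R : Type*} [Ring R] [Algebra ℚ R] (I : TwoSidedIdeal R)
    (n : ℕ) (hn : 0 < n) (hnil : ∀ x ∈ I, x ^ n = 0) :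
    ∃ m : ℕ, 0 < m ∧ ∀ f : Fin m → R, (∀ i, f i ∈ I) → (List.ofFn f).prod = 0 := by
  obtain ⟨m, hm, h⟩ := TwoSidedIdeal.exists_prod_mem_of_pow_mem (I := I) n ⊥
    fun x hx => (TwoSidedIdeal.mem_bot R).2 (hnil x hx)
  refine ⟨m, hm, fun f hf => (TwoSidedIdeal.mem_bot R).1 (h _ List.length_ofFn ?_)⟩
  intro x hx
  obtain ⟨i, rfl⟩ := List.mem_ofFn.1 hx
  exact hf i
end

section
/- Let C and D be pretriangulated categories and F : C ⥤ D an additive functor which commutes with the shift functors and sends distinguished triangles to distinguished triangles. Suppose that for every object X of C, every endomorphism f : X ⟶ X with F(f) = 0 is nilpotent (some iterated composite of f with itself is zero). Then F is conservative. -/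
open CategoryTheory Limits Pretriangulated

/-- Iterated composition of an endomorphism with itself. -/
def compPow {A : Type*} [Category A] {X : A} (f : X ⟶ X) : ℕ → (X ⟶ X)
  | 0 => 𝟙 X
  | n + 1 => f ≫ compPow f n

theorem compPow_id {A : Type*} [Category A] (X : A) (n : ℕ) : compPow (𝟙 X) n = 𝟙 X := by
  induction n with
  | zero => rfl
  | succ n ih => rw [compPow, ih, Category.comp_id]

/-- A functor for which every endomorphism sent to zero is nilpotent reflects zero objects. -/
theorem isZero_of_isZero_map_of_nil_kernel {C D : Type*} [Category C] [Category D]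
    [Preadditive C] [Preadditive D] (F : C ⥤ D)
    (hnil : ∀ (X : C) (f : X ⟶ X), F.map f = 0 → ∃ n : ℕ, 0 < n ∧ compPow f n = 0)
    {X : C} (hX : IsZero (F.obj X)) : IsZero X := by
  obtain ⟨n, -, hn⟩ := hnil X (𝟙 X) (hX.eq_of_src _ _)
  rw [compPow_id] at hn
  exact (IsZero.iff_id_eq_zero X).2 hn

/-- A triangulated functor between pretriangulated categories whose kernel ideal consists of
nilpotent endomorphisms is conservative. -/
theorem triangulated_functor_nil_kernel_is_conservative
    {C D : Type*} [Category C] [Category D]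
    [Preadditive C] [Preadditive D] [HasZeroObject C] [HasZeroObject D]
    [HasShift C ℤ] [HasShift D ℤ]
    [∀ n : ℤ, (shiftFunctor C n).Additive] [∀ n : ℤ, (shiftFunctor D n).Additive]
    [Pretriangulated C] [Pretriangulated D]
    (F : C ⥤ D) [F.Additive] [F.CommShift ℤ] [F.IsTriangulated]
    (hnil : ∀ (X : C) (f : X ⟶ X), F.map f = 0 → ∃ n : ℕ, 0 < n ∧ compPow f n = 0) :
    ∀ {X Y : C} (f : X ⟶ Y), IsIso (F.map f) → IsIso f := by
  intro X Y f hf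
  obtain ⟨Z, g, h, hT⟩ := distinguished_cocone_triangle f
  have hZ : IsZero (F.obj Z) :=
    (Triangle.isZero₃_iff_isIso₁ _ (F.map_distinguished _ hT)).2 hf
  exact (Triangle.isZero₃_iff_isIso₁ _ hT).1 (isZero_of_isZero_map_of_nil_kernel F hnil hZ)
end

section
/- Let A be a semisimple abelian category and K a cochain complex over A indexed by ℤ such that K^n = 0 for all n outside a finite interval [a, b]. Then in the derived category of A, K is isomorphic to the direct sum, over n ∈ [a, b], of the complexes having the n-th cohomology object H^n(K) placed in degree n and zero elsewhere. -/
open CategoryTheory Limits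

namespace HomologicalComplex

variable {C : Type*} {ι : Type} [Category C] [Abelian C] {c : ComplexShape ι}

instance : HasFiniteBiproducts (HomologicalComplex C c) := Abelian.hasFiniteBiproducts

lemma sum_homologyMap_biproduct_π_comp_ι {J : Type} [Fintype J]
    (F : J → HomologicalComplex C c) [HasBiproduct F] (i : ι) :
    ∑ j, homologyMap (biproduct.π F j) i ≫ homologyMap (biproduct.ι F j) i =
      𝟙 ((⨁ F).homology i) := by
  simp_rw [← homologyMap_comp]
  rw [← homologyMap_id, ← biproduct.total]
  exact ((homologyFunctor C c i).map_sum _ _).symm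

/-- In a biproduct of complexes, the inclusion of a summand is a homology isomorphism in degree `i`
when the other summands have no homology in degree `i`. -/
lemma isIso_homologyMap_biproduct_ι {J : Type} [Fintype J]
    (F : J → HomologicalComplex C c) [HasBiproduct F] (j : J) (i : ι)
    (hF : ∀ k, k ≠ j → IsZero ((F k).homology i)) :
    IsIso (homologyMap (biproduct.ι F j) i) := by
  refine ⟨homologyMap (biproduct.π F j) i, ?_, ?_⟩
  · rw [← homologyMap_comp, biproduct.ι_π_self, homologyMap_id]
  · rw [← sum_homologyMap_biproduct_π_comp_ι, Finset.sum_eq_single j _ (by simp)]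
    intro k _ hk
    rw [(hF k hk).eq_zero_of_tgt (homologyMap (biproduct.π F k) i), zero_comp]

lemma isZero_homology_biproduct {J : Type} [Fintype J]
    (F : J → HomologicalComplex C c) [HasBiproduct F] (i : ι)
    (hF : ∀ k, IsZero ((F k).homology i)) : IsZero ((⨁ F).homology i) := by
  rw [IsZero.iff_id_eq_zero, ← sum_homologyMap_biproduct_π_comp_ι]
  refine Finset.sum_eq_zero fun k _ ↦ ?_
  rw [(hF k).eq_zero_of_tgt (homologyMap (biproduct.π F k) i), zero_comp]

variable [DecidableEq ι]

/-- The morphism from a single complex induced by a section of `K.homologyπ j` induces an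
isomorphism in homology in degree `j`. -/
lemma isIso_homologyMap_mkHomFromSingle (K : HomologicalComplex C c) (j : ι)
    (s : K.homology j ⟶ K.cycles j) (hs : s ≫ K.homologyπ j = 𝟙 _)
    (h : ∀ k, c.Rel j k → (s ≫ K.iCycles j) ≫ K.d j k = 0) :
    IsIso (homologyMap (mkHomFromSingle (s ≫ K.iCycles j) h) j) := by
  have hcyc : (singleObjCyclesSelfIso c j (K.homology j)).inv ≫
      cyclesMap (mkHomFromSingle (s ≫ K.iCycles j) h) j = s := by
    simp [← cancel_mono (K.iCycles j)]
  have hom_eq : (singleObjHomologySelfIso c j (K.homology j)).inv ≫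
      homologyMap (mkHomFromSingle (s ≫ K.iCycles j) h) j = 𝟙 _ := by
    rw [← singleObjCyclesSelfIso_inv_homologyπ, Category.assoc, homologyπ_naturality,
      ← Category.assoc, hcyc, hs]
  rw [Iso.inv_comp_eq, Category.comp_id] at hom_eq
  rw [hom_eq]
  infer_instance

/-- If the projections from cycles to homology are split, a complex whose homology vanishes outside
a finite set of degrees receives a quasi-isomorphism from the direct sum of its homology objects. -/
lemma exists_quasiIso_biproduct_single_homology (K : HomologicalComplex C c) (S : Finset ι)
    (hK : ∀ i, i ∉ S → IsZero (K.homology i))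
    (hsplit : ∀ i, IsSplitEpi (K.homologyπ i)) :
    ∃ f : (⨁ fun i : S ↦ (single C c (i : ι)).obj (K.homology i)) ⟶ K, QuasiIso f := by
  let φ (i : ι) : (single C c i).obj (K.homology i) ⟶ K :=
    mkHomFromSingle (section_ (K.homologyπ i) ≫ K.iCycles i) (by simp)
  refine ⟨biproduct.desc fun i ↦ φ i, ⟨fun i ↦ ?_⟩⟩
  rw [quasiIsoAt_iff_isIso_homologyMap]
  by_cases hi : i ∈ S
  · have := isIso_homologyMap_biproduct_ι
      (fun i : S ↦ (single C c (i : ι)).obj (K.homology i)) ⟨i, hi⟩ i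
      (fun k hk ↦ isZero_single_obj_homology c _ _ _ fun h ↦ hk (Subtype.ext h.symm))
    have : IsIso (homologyMap (φ i) i) :=
      K.isIso_homologyMap_mkHomFromSingle i _ (IsSplitEpi.id _) _
    have hcomp := biproduct.ι_desc (fun i : S ↦ φ i) ⟨i, hi⟩
    apply_fun (homologyMap · i) at hcomp
    rw [homologyMap_comp] at hcomp
    exact IsIso.of_isIso_fac_left hcomp
  · have hsrc := isZero_homology_biproduct
      (fun i : S ↦ (single C c (i : ι)).obj (K.homology i)) i
      (fun k ↦ isZero_single_obj_homology c _ _ _ fun h ↦ hi (h ▸ k.2))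
    exact ⟨0, hsrc.eq_of_src _ _, (hK i hi).eq_of_src _ _⟩

end HomologicalComplex

/-- In an abelian category where all monomorphisms split, all epimorphisms split. -/
lemma CategoryTheory.Abelian.isSplitEpi_of_forall_mono_split {A : Type*} [Category A] [Abelian A]
    (hss : ∀ ⦃X Y : A⦄ (f : X ⟶ Y), Mono f → ∃ r : Y ⟶ X, f ≫ r = 𝟙 X)
    {X Y : A} (p : X ⟶ Y) [Epi p] : IsSplitEpi p := by
  obtain ⟨r, hr⟩ := hss (kernel.ι p) inferInstance
  have hexact : (ShortComplex.mk _ _ (kernel.condition p)).Exact :=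
    ShortComplex.exact_of_f_is_kernel _ (kernelIsKernel p)
  let σ := ShortComplex.Splitting.ofExactOfRetraction _ hexact r hr inferInstance
  exact ⟨⟨⟨σ.s, σ.s_g⟩⟩⟩

/-- A bounded cochain complex over a semisimple abelian category is isomorphic, in the
derived category, to the direct sum of its cohomology objects placed in their respective
degrees. -/
theorem bounded_complex_iso_direct_sum_of_cohomology
    {A : Type*} [Category A] [Abelian A] [HasDerivedCategory A]
    (hss : ∀ ⦃X Y : A⦄ (f : X ⟶ Y), Mono f → ∃ r : Y ⟶ X, f ≫ r = 𝟙 X)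
    (K : CochainComplex A ℤ) (a b : ℤ)
    (hbdd : ∀ n : ℤ, n ∉ Finset.Icc a b → IsZero (K.X n)) :
    Nonempty (DerivedCategory.Q.obj K ≅
      ⨁ (fun n : (Finset.Icc a b : Finset ℤ) =>
        (DerivedCategory.singleFunctor A (n : ℤ)).obj (K.homology (n : ℤ)))) := by
  obtain ⟨f, hf⟩ := K.exists_quasiIso_biproduct_single_homology (Finset.Icc a b)
    (fun n hn ↦ (HomologicalComplex.exactAt_iff_isZero_homology K n).1
      (ShortComplex.exact_of_isZero_X₂ _ (hbdd n hn)))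
    (fun n ↦ Abelian.isSplitEpi_of_forall_mono_split hss _)
  exact ⟨(asIso (DerivedCategory.Q.map f)).symm ≪≫ DerivedCategory.Q.mapBiproduct _ ≪≫
    biproduct.mapIso fun n ↦ ((DerivedCategory.singleFunctorIsoCompQ A n).app _).symm⟩
end

section
/- Let C be a pretriangulated category with a monoidal structure such that for every object X the functors X ⊗ − and − ⊗ X commute with the shift functor and send distinguished triangles to distinguished triangles. Let S be a class of objects of C and let T be the smallest triangulated subcategory of C containing S, i.e. the smallest class of objects containing S and the zero objects, closed under isomorphism, closed under the shift functor in both directions, and such that whenever two of the three objects of a distinguished triangle lie in the class, so does the third. If X ⊗ Y belongs to T for all X, Y in S, then X ⊗ Y belongs to T for all X, Y in T. -/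
open CategoryTheory Limits Pretriangulated MonoidalCategory

/-- If the tensor functors of a monoidal pretriangulated category are triangulated, then the
smallest triangulated subcategory `T` containing a class of objects `S` which is stable under
tensor products of objects of `S` is stable under all tensor products. -/
theorem triangulated_subcategory_generated_stable_under_tensor
    {C : Type*} [Category C] [Preadditive C] [HasZeroObject C] [HasShift C ℤ]
    [∀ n : ℤ, (shiftFunctor C n).Additive] [Pretriangulated C] [MonoidalCategory C]
    (commL : ∀ X : C, (tensorLeft X).CommShift ℤ)
    (commR : ∀ X : C, (tensorRight X).CommShift ℤ)
    (triL : ∀ X : C, letI := commL X; (tensorLeft X).IsTriangulated)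
    (triR : ∀ X : C, letI := commR X; (tensorRight X).IsTriangulated)
    (S T : Set C)
    -- `T` contains `S`, the zero objects, and is closed under isomorphisms, shifts in both
    -- directions and the two-out-of-three property for distinguished triangles:
    (hS : S ⊆ T)
    (hzero : ∀ X : C, IsZero X → X ∈ T)
    (hiso : ∀ {X Y : C}, (X ≅ Y) → X ∈ T → Y ∈ T)
    (hshift : ∀ (X : C) (n : ℤ), X ∈ T → X⟦n⟧ ∈ T)
    (h2of3 : ∀ Tr ∈ distTriang C,
      (Tr.obj₁ ∈ T → Tr.obj₂ ∈ T → Tr.obj₃ ∈ T) ∧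
      (Tr.obj₁ ∈ T → Tr.obj₃ ∈ T → Tr.obj₂ ∈ T) ∧
      (Tr.obj₂ ∈ T → Tr.obj₃ ∈ T → Tr.obj₁ ∈ T))
    -- ... and `T` is the smallest such class:
    (hmin : ∀ T' : Set C, S ⊆ T' → (∀ X : C, IsZero X → X ∈ T') →
      (∀ {X Y : C}, (X ≅ Y) → X ∈ T' → Y ∈ T') →
      (∀ (X : C) (n : ℤ), X ∈ T' → X⟦n⟧ ∈ T') →
      (∀ Tr ∈ distTriang C,
        (Tr.obj₁ ∈ T' → Tr.obj₂ ∈ T' → Tr.obj₃ ∈ T') ∧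
        (Tr.obj₁ ∈ T' → Tr.obj₃ ∈ T' → Tr.obj₂ ∈ T') ∧
        (Tr.obj₂ ∈ T' → Tr.obj₃ ∈ T' → Tr.obj₁ ∈ T')) →
      T ⊆ T')
    (htens : ∀ X ∈ S, ∀ Y ∈ S, X ⊗ Y ∈ T) :
    ∀ X ∈ T, ∀ Y ∈ T, X ⊗ Y ∈ T := by
  have key : ∀ (F : C ⥤ C) [F.CommShift ℤ] [F.IsTriangulated],
      (∀ X ∈ S, F.obj X ∈ T) → ∀ X ∈ T, F.obj X ∈ T := by
    intro F _ _ hF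
    exact hmin (F.obj ⁻¹' T) hF (fun X hX => hzero _ (F.map_isZero hX))
      (fun e hX => hiso (F.mapIso e) hX)
      (fun X n hX => hiso ((F.commShiftIso n).symm.app X) (hshift _ n hX))
      (fun Tr hTr => h2of3 _ (F.map_distinguished Tr hTr))
  have hleft : ∀ X ∈ S, ∀ Y ∈ T, X ⊗ Y ∈ T := by
    intro X hX
    let := commL X
    have := triL X
    exact key (tensorLeft X) (htens X hX)
  intro X hX Y hY
  let := commR Y
  have := triR Y
  exact key (tensorRight Y) (fun Z hZ => hleft Z hZ Y hY) X hX
end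

section
/- Let A be a semisimple abelian category and let K and L be cochain complexes over A indexed by ℤ, each vanishing in all degrees outside a finite interval. Then the canonical map from Hom(K, L), computed in the derived category of A, to the product over n ∈ ℤ of Hom_A(H^n(K), H^n(L)), given by applying the cohomology functors, is bijective. -/
open CategoryTheory Limits

namespace CategoryTheory.Abelian

variable {A : Type*} [Category A] [Abelian A]

/-- If all monomorphisms of an abelian category split, so do all epimorphisms. -/
lemma exists_section_of_forall_mono_split
    (hss : ∀ ⦃X Y : A⦄ (f : X ⟶ Y), Mono f → ∃ r : Y ⟶ X, f ≫ r = 𝟙 X)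
    {X Y : A} (f : X ⟶ Y) [Epi f] : ∃ s : Y ⟶ X, s ≫ f = 𝟙 Y := by
  obtain ⟨r, hr⟩ := hss (kernel.ι f) inferInstance
  let S := ShortComplex.mk (kernel.ι f) f (kernel.condition f)
  have hS : S.Exact := ShortComplex.exact_of_f_is_kernel _ (kernelIsKernel f)
  have : Epi S.g := inferInstanceAs (Epi f)
  exact ⟨_, (ShortComplex.Splitting.ofExactOfRetraction S hS r hr this).s_g⟩

end CategoryTheory.Abelian

namespace CochainComplex

variable {A : Type*} [Category A] [Abelian A]

/-- A choice of splittings of `H^n(K)` as a subquotient of `K.X n`, for all `n`. -/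
structure HomologySplitting (K : CochainComplex A ℤ) where
  /-- a section of the projection from cycles to homology -/
  σ (n : ℤ) : K.homology n ⟶ K.cycles n
  /-- a retraction of the inclusion of homology in opcycles -/
  ρ (n : ℤ) : K.opcycles n ⟶ K.homology n
  σ_π (n : ℤ) : σ n ≫ K.homologyπ n = 𝟙 _
  ι_ρ (n : ℤ) : K.homologyι n ≫ ρ n = 𝟙 _

namespace HomologySplitting

attribute [simp] σ_π ι_ρ

lemma nonempty_of_forall_mono_split
    (hss : ∀ ⦃X Y : A⦄ (f : X ⟶ Y), Mono f → ∃ r : Y ⟶ X, f ≫ r = 𝟙 X)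
    (K : CochainComplex A ℤ) : Nonempty (HomologySplitting K) := by
  choose σ hσ using fun n => Abelian.exists_section_of_forall_mono_split hss (K.homologyπ n)
  choose ρ hρ using fun n => hss (K.homologyι n) inferInstance
  exact ⟨⟨σ, ρ, hσ, hρ⟩⟩

variable {K L : CochainComplex A ℤ} (hK : HomologySplitting K) (hL : HomologySplitting L)

@[simp]
lemma σ_π_assoc (n : ℤ) {Z : A} (f : K.homology n ⟶ Z) :
    hK.σ n ≫ K.homologyπ n ≫ f = f := by
  rw [← Category.assoc, hK.σ_π, Category.id_comp]

@[simp]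
lemma ι_ρ_assoc (n : ℤ) {Z : A} (f : K.homology n ⟶ Z) :
    K.homologyι n ≫ hK.ρ n ≫ f = f := by
  rw [← Category.assoc, hK.ι_ρ, Category.id_comp]

/-- The morphism of complexes induced by a family of maps in cohomology. -/
noncomputable def lift (g : ∀ n, K.homology n ⟶ L.homology n) : K ⟶ L where
  f n := K.pOpcycles n ≫ hK.ρ n ≫ g n ≫ hL.σ n ≫ L.iCycles n
  comm' i j _ := by simp

@[simp]
lemma homologyMap_lift (g : ∀ n, K.homology n ⟶ L.homology n) (n : ℤ) :
    HomologicalComplex.homologyMap (lift hK hL g) n = g n := by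
  rw [← cancel_epi (K.homologyπ n), ← cancel_mono (L.homologyι n)]
  simp only [HomologicalComplex.homologyπ_naturality_assoc, HomologicalComplex.homology_π_ι,
    HomologicalComplex.cyclesMap_i_assoc, lift, Category.assoc]
  rw [← K.homology_π_ι_assoc, ← L.homology_π_ι, ι_ρ_assoc, σ_π_assoc]

instance quasiIso_lift_id : QuasiIso (lift hK hK fun _ => 𝟙 _) where
  quasiIsoAt n := by
    rw [quasiIsoAt_iff_isIso_homologyMap, homologyMap_lift]
    infer_instance

lemma lift_id_comp_comp_lift_id_eq_zero (f : K ⟶ L)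
    (hf : ∀ n, HomologicalComplex.homologyMap f n = 0) :
    lift hK hK (fun _ => 𝟙 _) ≫ f ≫ lift hL hL (fun _ => 𝟙 _) = 0 := by
  ext n
  have h : K.iCycles n ≫ f.f n ≫ L.pOpcycles n = 0 := by
    rw [← HomologicalComplex.cyclesMap_i_assoc, ← HomologicalComplex.homology_π_ι,
      ← HomologicalComplex.homologyπ_naturality_assoc, hf, zero_comp, comp_zero]
  have h_assoc {Z : A} (z : L.opcycles n ⟶ Z) :
      K.iCycles n ≫ f.f n ≫ L.pOpcycles n ≫ z = 0 := by
    simpa only [Category.assoc, zero_comp] using h =≫ z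
  simp [lift, h_assoc]

end HomologySplitting

end CochainComplex

namespace DerivedCategory

variable {A : Type*} [Category A] [Abelian A] [HasDerivedCategory A]

lemma Q_map_eq_zero_of_homologySplitting {K L : CochainComplex A ℤ}
    (hK : K.HomologySplitting) (hL : L.HomologySplitting) (f : K ⟶ L)
    (hf : ∀ n, HomologicalComplex.homologyMap f n = 0) : Q.map f = 0 := by
  have h := Q.congr_map (hK.lift_id_comp_comp_lift_id_eq_zero hL f hf)
  rw [Q.map_comp, Q.map_comp, Q.map_zero] at h
  rwa [← cancel_mono (Q.map (hL.lift hL fun _ => 𝟙 _)),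
    ← cancel_epi (Q.map (hK.lift hK fun _ => 𝟙 _)), zero_comp, comp_zero]

lemma homologyMap_eq_zero_of_homologyFunctor_map_eq_zero {K L : CochainComplex A ℤ}
    (f : K ⟶ L) (n : ℤ) (hf : (homologyFunctor A n).map (Q.map f) = 0) :
    HomologicalComplex.homologyMap f n = 0 := by
  have h := (homologyFunctorFactors A n).hom.naturality f
  dsimp at h
  rwa [hf, zero_comp, eq_comm, Preadditive.IsIso.comp_left_eq_zero] at h

end DerivedCategory

/-- For bounded complexes over a semisimple abelian category, morphisms in the derived
category are determined by, and realize arbitrarily, the induced maps on cohomology: the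
canonical map `Hom(K, L) ⟶ ∏ₙ Hom(Hⁿ(K), Hⁿ(L))` is bijective. -/
theorem hom_in_derived_category_bijective_to_cohomology_maps
    {A : Type*} [Category A] [Abelian A] [HasDerivedCategory A]
    (hss : ∀ ⦃X Y : A⦄ (f : X ⟶ Y), Mono f → ∃ r : Y ⟶ X, f ≫ r = 𝟙 X)
    (K L : CochainComplex A ℤ) (a b c d : ℤ)
    (hK : ∀ n : ℤ, n ∉ Finset.Icc a b → IsZero (K.X n))
    (hL : ∀ n : ℤ, n ∉ Finset.Icc c d → IsZero (L.X n)) :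
    Function.Bijective
      (fun (φ : DerivedCategory.Q.obj K ⟶ DerivedCategory.Q.obj L) =>
        (fun n : ℤ =>
          (DerivedCategory.homologyFunctorFactors A n).inv.app K ≫
            (DerivedCategory.homologyFunctor A n).map φ ≫
            (DerivedCategory.homologyFunctorFactors A n).hom.app L :
          ∀ n : ℤ, K.homology n ⟶ L.homology n)) := by
  have hs := CochainComplex.HomologySplitting.nonempty_of_forall_mono_split hss
  constructor
  · intro φ ψ h
    rw [← sub_eq_zero]
    obtain ⟨X, t, ht, g, hg⟩ := DerivedCategory.right_fac (φ - ψ)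
    have hzero (n : ℤ) : (DerivedCategory.homologyFunctor A n).map (φ - ψ) = 0 := by
      rw [Functor.map_sub, sub_eq_zero]
      exact (cancel_mono ((DerivedCategory.homologyFunctorFactors A n).hom.app L)).1
        ((cancel_epi ((DerivedCategory.homologyFunctorFactors A n).inv.app K)).1 (congrFun h n))
    have hg' : DerivedCategory.Q.map t ≫ (φ - ψ) = DerivedCategory.Q.map g := by simp [hg]
    rw [hg, DerivedCategory.Q_map_eq_zero_of_homologySplitting (hs X).some (hs L).some g,
      comp_zero]
    intro n
    apply DerivedCategory.homologyMap_eq_zero_of_homologyFunctor_map_eq_zero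
    rw [← hg', Functor.map_comp, hzero, comp_zero]
  · intro g
    refine ⟨DerivedCategory.Q.map ((hs K).some.lift (hs L).some g), funext fun n => ?_⟩
    refine (congrArg ((DerivedCategory.homologyFunctorFactors A n).inv.app K ≫ ·)
      ((DerivedCategory.homologyFunctorFactors A n).hom.naturality _)).trans ?_
    exact (Iso.inv_hom_id_app_assoc _ _ _).trans
      (CochainComplex.HomologySplitting.homologyMap_lift _ _ g n)
end
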